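/- arXiv:1910.13178 — 5 statements merged into one kernel-verified Lean document; each statement's English description precedes it below -/
import Mathlib

section
/- For every Borel probability measure h on Q there exists a search S₀ that is optimal for h; that is, T(S₀,h) = inf over all searches S of T(S,h), so the infimum of the expected search time is attained. -/
open MeasureTheory Set Filter
open scoped ENNReal

noncomputable section

/-- A search of the interval network `Q = [-l₂, l₁]` with root `0`:
a 1-Lipschitz function on `[0,∞)` taking values in `Q` and starting at the root. -/
def IsSearch (l₁ l₂ : ℝ) (S : ℝ → ℝ) : Prop :=
  S 0 = 0 ∧ (∀ t, 0 ≤ t → S t ∈ Icc (-l₂) l₁) ∧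
    (∀ s t, 0 ≤ s → 0 ≤ t → |S s - S t| ≤ |s - t|)

/-- The search time `T(S,x) = inf {t ≥ 0 : S t = x}`, with value `∞` if `x` is never reached. -/
def searchTime (S : ℝ → ℝ) (x : ℝ) : ℝ≥0∞ :=
  sInf (ENNReal.ofReal '' {t : ℝ | 0 ≤ t ∧ S t = x})

/-- The expected search time `T(S,h) = ∫_Q T(S,x) dh(x)`. -/
def expTime (S : ℝ → ℝ) (h : Measure ℝ) : ℝ≥0∞ :=
  ∫⁻ x, searchTime S x ∂h


theorem IsSearch.continuousOn {l₁ l₂ : ℝ} {S : ℝ → ℝ} (hS : IsSearch l₁ l₂ S) :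
    ContinuousOn S (Ici 0) := by
  have : LipschitzOnWith 1 S (Ici 0) :=
    LipschitzOnWith.of_dist_le_mul fun s hs t ht => by
      simpa [Real.dist_eq] using hS.2.2 s t hs ht
  exact this.continuousOn

theorem searchTime_le_ofReal_iff {S : ℝ → ℝ} (hS : ContinuousOn S (Ici 0)) {x c : ℝ} :
    searchTime S x ≤ ENNReal.ofReal c ↔ ∃ t, 0 ≤ t ∧ t ≤ max c 0 ∧ S t = x := by
  constructor
  · intro hc
    set A : Set ℝ := {t : ℝ | 0 ≤ t ∧ S t = x} with hA
    have hbdd : BddBelow A := ⟨0, fun t ht => ht.1⟩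
    have hne : A.Nonempty := by
      by_contra hemp
      rw [not_nonempty_iff_eq_empty] at hemp
      rw [searchTime, ← hA, hemp] at hc
      simp at hc
    have hclosed : IsClosed A := by
      have : IsClosed (Ici (0 : ℝ) ∩ S ⁻¹' {x}) :=
        hS.preimage_isClosed_of_isClosed isClosed_Ici isClosed_singleton
      exact this
    have hmem := hclosed.csInf_mem hne hbdd
    refine ⟨sInf A, hmem.1, ?_, hmem.2⟩
    have hle : ENNReal.ofReal (sInf A) ≤ searchTime S x := by
      refine le_sInf ?_
      rintro _ ⟨t, ht, rfl⟩
      exact ENNReal.ofReal_le_ofReal (csInf_le hbdd ht)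
    have := hle.trans hc
    rwa [ENNReal.ofReal_le_ofReal_iff', ← le_max_iff] at this
  · rintro ⟨t, ht0, htc, rfl⟩
    refine sInf_le_of_le ⟨t, ⟨ht0, rfl⟩, rfl⟩ ?_
    rw [ENNReal.ofReal_le_ofReal_iff', ← le_max_iff]
    exact htc

theorem measurable_searchTime {S : ℝ → ℝ} (hS : ContinuousOn S (Ici 0)) :
    Measurable (searchTime S) := by
  refine measurable_of_Iic fun c => ?_
  induction c with
  | top => simp
  | coe c =>
    have : searchTime S ⁻¹' Iic (c : ℝ≥0∞) = S '' Icc 0 (c : ℝ) := by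
      ext x
      have := searchTime_le_ofReal_iff hS (x := x) (c := c)
      rw [ENNReal.ofReal_coe_nnreal, max_eq_left c.coe_nonneg] at this
      simp only [mem_preimage, mem_Iic, this, mem_image, mem_Icc, and_assoc]
    rw [this]
    exact (isCompact_Icc.image_of_continuousOn
      (hS.mono Icc_subset_Ici_self)).isClosed.measurableSet

/-- The search time is lower semicontinuous under pointwise convergence of searches. -/
theorem searchTime_le_liminf {l₁ l₂ : ℝ} {S : ℕ → ℝ → ℝ} {S₀ : ℝ → ℝ}
    (hS : ∀ n, IsSearch l₁ l₂ (S n))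
    (hlim : ∀ t, 0 ≤ t → Tendsto (fun n => S n t) atTop (nhds (S₀ t))) (x : ℝ) :
    searchTime S₀ x ≤ liminf (fun n => searchTime (S n) x) atTop := by
  refine le_of_forall_gt_imp_ge_of_dense fun c hc => ?_
  induction c with
  | top => exact le_top
  | coe c =>
    have hfreq := frequently_lt_of_liminf_lt (by isBoundedDefault) hc
    obtain ⟨φ, hφ, hlt⟩ := extraction_of_frequently_atTop hfreq
    have hex : ∀ n, ∃ t, t ∈ Icc (0 : ℝ) c ∧ S (φ n) t = x := fun n => by
      have h1 := (hlt n).le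
      rw [← ENNReal.ofReal_coe_nnreal, searchTime_le_ofReal_iff (hS _).continuousOn,
        max_eq_left c.coe_nonneg] at h1
      obtain ⟨t, h0, h2, h3⟩ := h1
      exact ⟨t, ⟨h0, h2⟩, h3⟩
    choose t ht htx using hex
    obtain ⟨a, ha, ψ, hψ, hta⟩ := isCompact_Icc.tendsto_subseq ht
    have hSa := (hlim a ha.1).comp (hφ.tendsto_atTop.comp hψ.tendsto_atTop)
    have hdist : Tendsto (fun n => |S (φ (ψ n)) a - x|) atTop (nhds 0) := by
      have h0 : Tendsto (fun n => |a - t (ψ n)|) atTop (nhds 0) := by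
        simpa using (tendsto_const_nhds (x := a)).sub hta |>.abs
      refine squeeze_zero (fun _ => abs_nonneg _) (fun n => ?_) h0
      have := (hS (φ (ψ n))).2.2 a (t (ψ n)) ha.1 (ht _).1
      rwa [htx] at this
    have hx : S₀ a = x := by
      have h1 := (hSa.sub_const x).abs
      have h2 := tendsto_nhds_unique h1 hdist
      exact sub_eq_zero.mp (abs_eq_zero.mp h2)
    refine sInf_le_of_le ⟨a, ⟨ha.1, hx⟩, rfl⟩ ?_
    rw [← ENNReal.ofReal_coe_nnreal]
    exact ENNReal.ofReal_le_ofReal ha.2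

/-- Every sequence of searches has a subsequence converging pointwise on `[0,∞)` to a search. -/
theorem IsSearch.exists_subseq_tendsto {l₁ l₂ : ℝ} {S : ℕ → ℝ → ℝ}
    (hS : ∀ n, IsSearch l₁ l₂ (S n)) :
    ∃ (S₀ : ℝ → ℝ) (φ : ℕ → ℕ), IsSearch l₁ l₂ S₀ ∧ StrictMono φ ∧
      ∀ t, 0 ≤ t → Tendsto (fun n => S (φ n) t) atTop (nhds (S₀ t)) := by
  have hcpt : IsCompact (univ.pi fun _ : ℚ => Icc (-l₂) l₁) :=
    isCompact_univ_pi fun _ => isCompact_Icc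
  obtain ⟨g, -, φ, hφ, hg⟩ := hcpt.tendsto_subseq (x := fun n (q : ℚ) => S n |(q : ℝ)|)
    fun n q _ => (hS n).2.1 _ (abs_nonneg _)
  have hgq : ∀ q : ℚ, Tendsto (fun n => S (φ n) |(q : ℝ)|) atTop (nhds (g q)) :=
    fun q => tendsto_pi_nhds.mp hg q
  have hconv : ∀ t : ℝ, ∃ y, 0 ≤ t → Tendsto (fun n => S (φ n) t) atTop (nhds y) := by
    intro t
    by_cases ht : 0 ≤ t
    swap
    · exact ⟨0, fun h => absurd h ht⟩
    have hc : CauchySeq fun n => S (φ n) t := by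
      rw [Metric.cauchySeq_iff']
      intro ε hε
      obtain ⟨q, hq1, hq2⟩ := exists_rat_btwn (show t < t + ε / 4 by linarith)
      obtain ⟨N, hN⟩ := Metric.cauchySeq_iff'.mp (hgq q).cauchySeq (ε / 4) (by linarith)
      refine ⟨N, fun n hn => ?_⟩
      have hq0 : (0 : ℝ) ≤ q := ht.trans hq1.le
      have h1 := hN n hn
      rw [abs_of_nonneg hq0, Real.dist_eq] at h1
      have hqt : |t - q| < ε / 4 := by
        rw [abs_lt]; constructor <;> linarith
      have h2 := ((hS (φ n)).2.2 t q ht hq0).trans_lt hqt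
      have h3 := ((hS (φ N)).2.2 t q ht hq0).trans_lt hqt
      rw [Real.dist_eq]
      rw [abs_lt] at *
      constructor <;> linarith
    obtain ⟨y, hy⟩ := cauchySeq_tendsto_of_complete hc
    exact ⟨y, fun _ => hy⟩
  choose S₀ hS₀ using hconv
  refine ⟨S₀, φ, ⟨?_, fun t ht => ?_, fun s t hs ht => ?_⟩, hφ, hS₀⟩
  · refine tendsto_nhds_unique (hS₀ 0 le_rfl) ?_
    simp [(hS _).1]
  · exact isClosed_Icc.mem_of_tendsto (hS₀ t ht) (Eventually.of_forall fun n => (hS _).2.1 t ht)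
  · exact le_of_tendsto ((hS₀ s hs).sub (hS₀ t ht)).abs
      (Eventually.of_forall fun n => (hS _).2.2 s t hs ht)

/-- For every Borel probability measure `h` on `Q = [-l₂, l₁]` there exists an optimal
search `S₀`: its expected search time attains the infimum over all searches. -/
theorem exists_optimal_search (l₁ l₂ : ℝ) (hl₁ : 0 < l₁) (hl₂ : 0 < l₂)
    (h : Measure ℝ) [IsProbabilityMeasure h] (hsupp : h (Icc (-l₂) l₁) = 1) :
    ∃ S₀ : ℝ → ℝ, IsSearch l₁ l₂ S₀ ∧
      expTime S₀ h = ⨅ S : {S : ℝ → ℝ // IsSearch l₁ l₂ S}, expTime S.1 h := by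
  have hzero : IsSearch l₁ l₂ fun _ => 0 :=
    ⟨rfl, fun _ _ => ⟨by linarith, hl₁.le⟩, fun s t _ _ => by simp⟩
  have : Nonempty {S : ℝ → ℝ // IsSearch l₁ l₂ S} := ⟨⟨_, hzero⟩⟩
  obtain ⟨u, -, hu, hmem⟩ := exists_seq_tendsto_sInf
    (range_nonempty fun S : {S : ℝ → ℝ // IsSearch l₁ l₂ S} => expTime S.1 h)
    (OrderBot.bddBelow _)
  choose S hSu using hmem
  obtain ⟨S₀, φ, hS₀, hφ, hlim⟩ := IsSearch.exists_subseq_tendsto fun n => (S n).2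
  refine ⟨S₀, hS₀, le_antisymm ?_ (iInf_le (fun S : {S : ℝ → ℝ // IsSearch l₁ l₂ S} =>
    expTime S.1 h) ⟨S₀, hS₀⟩)⟩
  calc expTime S₀ h
      ≤ ∫⁻ x, liminf (fun n => searchTime (S (φ n)).1 x) atTop ∂h :=
        lintegral_mono fun x => searchTime_le_liminf (fun n => (S (φ n)).2) hlim x
    _ ≤ liminf (fun n => expTime (S (φ n)).1 h) atTop :=
        lintegral_liminf_le fun n => measurable_searchTime (S (φ n)).2.continuousOn
    _ = liminf (u ∘ φ) atTop := by
        congr 1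
        exact funext fun n => hSu (φ n)
    _ = ⨅ S : {S : ℝ → ℝ // IsSearch l₁ l₂ S}, expTime S.1 h :=
        (hu.comp hφ.tendsto_atTop).liminf_eq

end
end

section
/- (Search Density Lemma on the interval.) Let h be a hiding distribution and S a search with T(S,h) < ∞. Let 0 ≤ t₁ < t₂ < t₃ satisfy S(t₁) = S(t₂) = S(t₃), and suppose h(S([t₁,t₃])) = h(S([t₁,t₂])) + h(S([t₂,t₃])) (the two excursions are probabilistically disjoint). Define the transposed search S' by S'(t) = S(t) for t ≤ t₁ and for t ≥ t₃, S'(t) = S(t + (t₂−t₁)) for t₁ ≤ t ≤ t₁ + (t₃−t₂), and S'(t) = S(t − (t₃−t₂)) for t₁ + (t₃−t₂) ≤ t ≤ t₃. Set ρ₁ = [h(S([0,t₂])) − h(S([0,t₁]))]/(t₂−t₁) and ρ₂ = [h(S([0,t₃])) − h(S([0,t₂]))]/(t₃−t₂). Then T(S',h) − T(S,h) = (t₂−t₁)(t₃−t₂)(ρ₁−ρ₂); in particular, if ρ₁ ≥ ρ₂ then T(S,h) ≤ T(S',h), with equality if and only if ρ₁ = ρ₂. -/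
open MeasureTheory Set Filter
open scoped ENNReal

noncomputable section

/-- The search obtained from `S` by transposing the two excursions on `[t₁,t₂]` and
`[t₂,t₃]`. -/
def transposedSearch (S : ℝ → ℝ) (t₁ t₂ t₃ : ℝ) (t : ℝ) : ℝ :=
  if t ≤ t₁ then S t
  else if t ≤ t₁ + (t₃ - t₂) then S (t + (t₂ - t₁))
  else if t ≤ t₃ then S (t - (t₃ - t₂))
  else S t

theorem IsSearch.isCompact_image {l₁ l₂ : ℝ} {S : ℝ → ℝ} (hS : IsSearch l₁ l₂ S) {a b : ℝ}
    (ha : 0 ≤ a) : IsCompact (S '' Icc a b) := by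
  refine isCompact_Icc.image_of_continuousOn ?_
  have hL : LipschitzOnWith 1 S (Icc a b) := LipschitzOnWith.of_dist_le_mul fun s hs t ht => by
    simpa [Real.dist_eq] using hS.2.2 s t (ha.trans hs.1) (ha.trans ht.1)
  exact hL.continuousOn

/-- If every visit of `S` to `x` is matched by a visit of `S'` at most `c` later, then `S'` finds
`x` at most `c` later than `S`. -/
theorem searchTime_le_add {S S' : ℝ → ℝ} {x c : ℝ} (hc : 0 ≤ c)
    (H : ∀ t, 0 ≤ t → S t = x → ∃ s, 0 ≤ s ∧ S' s = x ∧ s ≤ t + c) :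
    searchTime S' x ≤ searchTime S x + ENNReal.ofReal c := by
  rw [← tsub_le_iff_right]
  refine le_sInf ?_
  rintro _ ⟨t, ⟨ht, hx⟩, rfl⟩
  obtain ⟨s, hs, hsx, hle⟩ := H t ht hx
  rw [tsub_le_iff_right, ← ENNReal.ofReal_add ht hc]
  exact sInf_le_of_le ⟨s, ⟨hs, hsx⟩, rfl⟩ (ENNReal.ofReal_le_ofReal hle)

/-- If every visit of `S` to `x` is matched by a visit of `S'` at least `c` earlier, then `S'`
finds `x` at least `c` earlier than `S`. -/
theorem searchTime_add_le {S S' : ℝ → ℝ} {x c : ℝ} (hc : 0 ≤ c)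
    (H : ∀ t, 0 ≤ t → S t = x → ∃ s, 0 ≤ s ∧ S' s = x ∧ s + c ≤ t) :
    searchTime S' x + ENNReal.ofReal c ≤ searchTime S x := by
  refine le_sInf ?_
  rintro _ ⟨t, ⟨ht, hx⟩, rfl⟩
  obtain ⟨s, hs, hsx, hle⟩ := H t ht hx
  refine le_trans ?_ (ENNReal.ofReal_le_ofReal hle)
  rw [ENNReal.ofReal_add hs hc]
  gcongr
  exact sInf_le ⟨s, ⟨hs, hsx⟩, rfl⟩

theorem searchTime_le {S S' : ℝ → ℝ} {x : ℝ}
    (H : ∀ t, 0 ≤ t → S t = x → ∃ s, 0 ≤ s ∧ S' s = x ∧ s ≤ t) :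
    searchTime S' x ≤ searchTime S x := by
  simpa using searchTime_le_add (c := 0) le_rfl (by simpa using H)

section Transposed

variable {S : ℝ → ℝ} {t₁ t₂ t₃ t x : ℝ}

theorem transposedSearch_of_le (ht : t ≤ t₁) : transposedSearch S t₁ t₂ t₃ t = S t := by
  simp [transposedSearch, ht]

theorem transposedSearch_of_mem_Ioc_left (ht : t ∈ Ioc t₁ (t₁ + (t₃ - t₂))) :
    transposedSearch S t₁ t₂ t₃ t = S (t + (t₂ - t₁)) := by
  simp [transposedSearch, ht.1.not_ge, ht.2]

theorem transposedSearch_of_mem_Ioc_right (h23 : t₂ ≤ t₃)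
    (ht : t ∈ Ioc (t₁ + (t₃ - t₂)) t₃) :
    transposedSearch S t₁ t₂ t₃ t = S (t - (t₃ - t₂)) := by
  have h1 : ¬ t ≤ t₁ := by linarith [ht.1]
  simp only [transposedSearch, if_neg h1, if_neg ht.1.not_ge, if_pos ht.2]

theorem transposedSearch_of_lt (h12 : t₁ ≤ t₂) (h23 : t₂ ≤ t₃) (ht : t₃ < t) :
    transposedSearch S t₁ t₂ t₃ t = S t := by
  have h1 : ¬ t ≤ t₁ := by linarith
  have h2 : ¬ t ≤ t₁ + (t₃ - t₂) := by linarith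
  simp only [transposedSearch, if_neg h1, if_neg h2, if_neg ht.not_ge]

/-- The four phases of the transposed search. -/
theorem transposedSearch_cases (S : ℝ → ℝ) (h12 : t₁ ≤ t₂) (h23 : t₂ ≤ t₃) (t : ℝ) :
    (t ≤ t₁ ∧ transposedSearch S t₁ t₂ t₃ t = S t) ∨
    (t ∈ Ioc t₁ (t₁ + (t₃ - t₂)) ∧ transposedSearch S t₁ t₂ t₃ t = S (t + (t₂ - t₁))) ∨
    (t ∈ Ioc (t₁ + (t₃ - t₂)) t₃ ∧ transposedSearch S t₁ t₂ t₃ t = S (t - (t₃ - t₂))) ∨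
    (t₃ < t ∧ transposedSearch S t₁ t₂ t₃ t = S t) := by
  rcases le_or_gt t t₁ with a | a
  · exact .inl ⟨a, transposedSearch_of_le a⟩
  rcases le_or_gt t (t₁ + (t₃ - t₂)) with b | b
  · exact .inr (.inl ⟨⟨a, b⟩, transposedSearch_of_mem_Ioc_left ⟨a, b⟩⟩)
  rcases le_or_gt t t₃ with c | c
  · exact .inr (.inr (.inl ⟨⟨b, c⟩, transposedSearch_of_mem_Ioc_right h23 ⟨b, c⟩⟩))
  · exact .inr (.inr (.inr ⟨c, transposedSearch_of_lt h12 h23 c⟩))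

theorem searchTime_transposed_of_mem (hx : x ∈ S '' Icc 0 t₁) :
    searchTime (transposedSearch S t₁ t₂ t₃) x = searchTime S x := by
  obtain ⟨r, hr, hrx⟩ := hx
  have hr' : transposedSearch S t₁ t₂ t₃ r = x := by rw [transposedSearch_of_le hr.2, hrx]
  apply le_antisymm <;> refine searchTime_le fun t ht htx => ?_
  · rcases le_or_gt t t₁ with a | a
    · exact ⟨t, ht, by rw [transposedSearch_of_le a, htx], le_rfl⟩
    · exact ⟨r, hr.1, hr', by linarith [hr.2]⟩
  · rcases le_or_gt t t₁ with a | a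
    · exact ⟨t, ht, by rw [← htx, transposedSearch_of_le a], le_rfl⟩
    · exact ⟨r, hr.1, hrx, by linarith [hr.2]⟩

theorem searchTime_transposed_of_mem_first (ht₁ : 0 ≤ t₁) (h12 : t₁ ≤ t₂) (h23 : t₂ ≤ t₃)
    (h0 : x ∉ S '' Icc 0 t₁) (h1 : x ∈ S '' Icc t₁ t₂) (h2 : x ∉ S '' Icc t₂ t₃) :
    searchTime (transposedSearch S t₁ t₂ t₃) x = searchTime S x + ENNReal.ofReal (t₃ - t₂) := by
  obtain ⟨r, hr, hrx⟩ := h1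
  apply le_antisymm
  · refine searchTime_le_add (sub_nonneg.2 h23) fun t ht htx => ?_
    rcases le_or_gt t t₁ with a | a
    · exact absurd ⟨t, ⟨ht, a⟩, htx⟩ h0
    rcases le_or_gt t t₂ with b | b
    · refine ⟨t + (t₃ - t₂), by linarith, ?_, le_rfl⟩
      rw [transposedSearch_of_mem_Ioc_right h23 ⟨by linarith, by linarith⟩, add_sub_cancel_right,
        htx]
    rcases le_or_gt t t₃ with c | c
    · exact absurd ⟨t, ⟨b.le, c⟩, htx⟩ h2
    · exact ⟨t, ht, by rw [transposedSearch_of_lt h12 h23 c, htx], by linarith⟩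
  · refine searchTime_add_le (sub_nonneg.2 h23) fun t ht htx => ?_
    rcases transposedSearch_cases S h12 h23 t with ⟨a, e⟩ | ⟨a, e⟩ | ⟨a, e⟩ | ⟨a, e⟩ <;>
      rw [htx] at e
    · exact absurd ⟨t, ⟨ht, a⟩, e.symm⟩ h0
    · exact absurd ⟨_, ⟨by linarith [a.1], by linarith [a.2]⟩, e.symm⟩ h2
    · exact ⟨_, by linarith [a.1], e.symm, by linarith⟩
    · exact ⟨r, ht₁.trans hr.1, hrx, by linarith [hr.2]⟩

theorem searchTime_transposed_of_mem_second (ht₁ : 0 ≤ t₁) (h12 : t₁ ≤ t₂) (h23 : t₂ ≤ t₃)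
    (h0 : x ∉ S '' Icc 0 t₁) (h1 : x ∉ S '' Icc t₁ t₂) (h2 : x ∈ S '' Icc t₂ t₃) :
    searchTime (transposedSearch S t₁ t₂ t₃) x + ENNReal.ofReal (t₂ - t₁) = searchTime S x := by
  have shift : ∀ r, t₂ < r → r ≤ t₃ →
      transposedSearch S t₁ t₂ t₃ (r - (t₂ - t₁)) = S r := fun r hr hr' => by
    rw [transposedSearch_of_mem_Ioc_left ⟨by linarith, by linarith⟩, sub_add_cancel]
  obtain ⟨r, hr, hrx⟩ := h2
  have hr₂ : t₂ < r := hr.1.lt_of_ne fun e => h1 ⟨r, ⟨by linarith, e.ge⟩, hrx⟩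
  apply le_antisymm
  · refine searchTime_add_le (sub_nonneg.2 h12) fun t ht htx => ?_
    rcases le_or_gt t t₁ with a | a
    · exact absurd ⟨t, ⟨ht, a⟩, htx⟩ h0
    rcases le_or_gt t t₂ with b | b
    · exact absurd ⟨t, ⟨a.le, b⟩, htx⟩ h1
    rcases le_or_gt t t₃ with c | c
    · exact ⟨t - (t₂ - t₁), by linarith, by rw [shift t b c, htx], by linarith⟩
    · exact ⟨r - (t₂ - t₁), by linarith, by rw [shift r hr₂ hr.2, hrx], by linarith [hr.2]⟩
  · refine searchTime_le_add (sub_nonneg.2 h12) fun t ht htx => ?_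
    rcases transposedSearch_cases S h12 h23 t with ⟨a, e⟩ | ⟨a, e⟩ | ⟨a, e⟩ | ⟨a, e⟩ <;>
      rw [htx] at e
    · exact absurd ⟨t, ⟨ht, a⟩, e.symm⟩ h0
    · exact ⟨_, by linarith [a.1], e.symm, le_rfl⟩
    · exact absurd ⟨_, ⟨by linarith [a.1], by linarith [a.2]⟩, e.symm⟩ h1
    · exact ⟨t, ht, e.symm, by linarith⟩

theorem searchTime_transposed_of_notMem (h12 : t₁ ≤ t₂) (h23 : t₂ ≤ t₃)
    (h0 : x ∉ S '' Icc 0 t₁) (h1 : x ∉ S '' Icc t₁ t₂) (h2 : x ∉ S '' Icc t₂ t₃) :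
    searchTime (transposedSearch S t₁ t₂ t₃) x = searchTime S x := by
  apply le_antisymm <;> refine searchTime_le fun t ht htx => ?_
  · rcases le_or_gt t t₁ with a | a
    · exact absurd ⟨t, ⟨ht, a⟩, htx⟩ h0
    rcases le_or_gt t t₂ with b | b
    · exact absurd ⟨t, ⟨a.le, b⟩, htx⟩ h1
    rcases le_or_gt t t₃ with c | c
    · exact absurd ⟨t, ⟨b.le, c⟩, htx⟩ h2
    · exact ⟨t, ht, by rw [transposedSearch_of_lt h12 h23 c, htx], le_rfl⟩
  · rcases transposedSearch_cases S h12 h23 t with ⟨a, e⟩ | ⟨a, e⟩ | ⟨a, e⟩ | ⟨a, e⟩ <;>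
      rw [htx] at e
    · exact absurd ⟨t, ⟨ht, a⟩, e.symm⟩ h0
    · exact absurd ⟨_, ⟨by linarith [a.1], by linarith [a.2]⟩, e.symm⟩ h2
    · exact absurd ⟨_, ⟨by linarith [a.1], by linarith [a.2]⟩, e.symm⟩ h1
    · exact ⟨t, ht, e.symm, le_rfl⟩

/-- Away from points visited in both excursions, transposition delays the points newly found in
the first excursion by `t₃ - t₂` and advances those newly found in the second by `t₂ - t₁`. -/
theorem searchTime_transposed_add_indicator (ht₁ : 0 ≤ t₁) (h12 : t₁ ≤ t₂) (h23 : t₂ ≤ t₃)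
    (hx : x ∉ S '' Icc t₁ t₂ ∩ S '' Icc t₂ t₃) :
    searchTime (transposedSearch S t₁ t₂ t₃) x
        + (S '' Icc 0 t₃ \ S '' Icc 0 t₂).indicator (fun _ => ENNReal.ofReal (t₂ - t₁)) x
      = searchTime S x
        + (S '' Icc 0 t₂ \ S '' Icc 0 t₁).indicator (fun _ => ENNReal.ofReal (t₃ - t₂)) x := by
  have e2 : S '' Icc 0 t₂ = S '' Icc 0 t₁ ∪ S '' Icc t₁ t₂ := by
    rw [← image_union, Icc_union_Icc_eq_Icc ht₁ h12]
  have e3 : S '' Icc 0 t₃ = S '' Icc 0 t₂ ∪ S '' Icc t₂ t₃ := by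
    rw [← image_union, Icc_union_Icc_eq_Icc (ht₁.trans h12) h23]
  classical
  rw [e3, e2]
  simp only [indicator_apply, Set.mem_sdiff, mem_union]
  by_cases h0 : x ∈ S '' Icc 0 t₁
  · simp [h0, searchTime_transposed_of_mem h0]
  by_cases h1 : x ∈ S '' Icc t₁ t₂
  · have h2 : x ∉ S '' Icc t₂ t₃ := fun h2 => hx ⟨h1, h2⟩
    simp only [h0, h1, h2, searchTime_transposed_of_mem_first ht₁ h12 h23 h0 h1 h2]
    simp
  by_cases h2 : x ∈ S '' Icc t₂ t₃
  · simp only [h0, h1, h2, ← searchTime_transposed_of_mem_second ht₁ h12 h23 h0 h1 h2]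
    simp
  · simp only [h0, h1, h2, searchTime_transposed_of_notMem h12 h23 h0 h1 h2]
    simp

end Transposed

theorem expTime_transposed_add {l₁ l₂ : ℝ} {h : Measure ℝ} [IsFiniteMeasure h] {S : ℝ → ℝ}
    (hS : IsSearch l₁ l₂ S) {t₁ t₂ t₃ : ℝ} (ht₁ : 0 ≤ t₁) (h12 : t₁ ≤ t₂) (h23 : t₂ ≤ t₃)
    (hdisj : h (S '' Icc t₁ t₃) = h (S '' Icc t₁ t₂) + h (S '' Icc t₂ t₃)) :
    expTime (transposedSearch S t₁ t₂ t₃) h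
        + ENNReal.ofReal (t₂ - t₁) * h (S '' Icc 0 t₃ \ S '' Icc 0 t₂)
      = expTime S h + ENNReal.ofReal (t₃ - t₂) * h (S '' Icc 0 t₂ \ S '' Icc 0 t₁) := by
  have hmeas : ∀ {a b : ℝ}, 0 ≤ a → MeasurableSet (S '' Icc a b) := fun ha =>
    (hS.isCompact_image ha).measurableSet
  have hnull : h (S '' Icc t₁ t₂ ∩ S '' Icc t₂ t₃) = 0 := by
    have H := measure_union_add_inter (μ := h) (S '' Icc t₁ t₂) (hmeas (b := t₃) (ht₁.trans h12))
    rw [← image_union, Icc_union_Icc_eq_Icc h12 h23, ← hdisj] at H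
    exact (ENNReal.add_right_inj (measure_ne_top h (S '' Icc t₁ t₃))).1 (H.trans (add_zero _).symm)
  have hD2 := (hmeas (b := t₃) le_rfl).diff (hmeas (b := t₂) le_rfl)
  have hD1 := (hmeas (b := t₂) le_rfl).diff (hmeas (b := t₁) le_rfl)
  rw [expTime, expTime, ← lintegral_indicator_const hD2, ← lintegral_indicator_const hD1,
    ← lintegral_add_right _ (measurable_const.indicator hD2),
    ← lintegral_add_right _ (measurable_const.indicator hD1)]
  refine lintegral_congr_ae ?_
  filter_upwards [measure_eq_zero_iff_ae_notMem.1 hnull] with x hx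
  exact searchTime_transposed_add_indicator ht₁ h12 h23 hx

/-- The Search Density Lemma on the interval: transposing two probabilistically disjoint
excursions changes the expected search time by `(t₂-t₁)(t₃-t₂)(ρ₁-ρ₂)`; in particular if
`ρ₁ ≥ ρ₂` the original order is at least as good, with equality iff `ρ₁ = ρ₂`. -/
theorem search_density_lemma (l₁ l₂ : ℝ) (hl₁ : 0 < l₁) (hl₂ : 0 < l₂)
    (h : Measure ℝ) [IsProbabilityMeasure h] (hsupp : h (Icc (-l₂) l₁) = 1)
    (S : ℝ → ℝ) (hS : IsSearch l₁ l₂ S) (hfin : expTime S h ≠ ⊤)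
    (t₁ t₂ t₃ : ℝ) (ht₁ : 0 ≤ t₁) (h12 : t₁ < t₂) (h23 : t₂ < t₃)
    (hret₁ : S t₁ = S t₂) (hret₂ : S t₂ = S t₃)
    (hdisj : h (S '' Icc t₁ t₃) = h (S '' Icc t₁ t₂) + h (S '' Icc t₂ t₃)) :
    expTime (transposedSearch S t₁ t₂ t₃) h ≠ ⊤ ∧
    (expTime (transposedSearch S t₁ t₂ t₃) h).toReal - (expTime S h).toReal
      = (t₂ - t₁) * (t₃ - t₂) *
        (((h (S '' Icc 0 t₂)).toReal - (h (S '' Icc 0 t₁)).toReal) / (t₂ - t₁)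
          - ((h (S '' Icc 0 t₃)).toReal - (h (S '' Icc 0 t₂)).toReal) / (t₃ - t₂)) ∧
    ((((h (S '' Icc 0 t₃)).toReal - (h (S '' Icc 0 t₂)).toReal) / (t₃ - t₂)
        ≤ ((h (S '' Icc 0 t₂)).toReal - (h (S '' Icc 0 t₁)).toReal) / (t₂ - t₁)) →
      (expTime S h ≤ expTime (transposedSearch S t₁ t₂ t₃) h ∧
        (expTime S h = expTime (transposedSearch S t₁ t₂ t₃) h ↔
          ((h (S '' Icc 0 t₂)).toReal - (h (S '' Icc 0 t₁)).toReal) / (t₂ - t₁)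
            = ((h (S '' Icc 0 t₃)).toReal - (h (S '' Icc 0 t₂)).toReal) / (t₃ - t₂)))) := by
  have key := expTime_transposed_add hS ht₁ h12.le h23.le hdisj
  have hdiff : ∀ {a b : ℝ}, a ≤ b → (h (S '' Icc 0 b \ S '' Icc 0 a)).toReal
      = (h (S '' Icc 0 b)).toReal - (h (S '' Icc 0 a)).toReal := fun hab =>
    measureReal_sdiff (μ := h) (image_mono (Icc_subset_Icc_right hab))
      (hS.isCompact_image le_rfl).measurableSet
  have hmul : ∀ (c : ℝ) (s : Set ℝ), ENNReal.ofReal c * h s ≠ ⊤ := fun c s =>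
    ENNReal.mul_ne_top ENNReal.ofReal_ne_top (measure_ne_top h s)
  have hfin' : expTime (transposedSearch S t₁ t₂ t₃) h ≠ ⊤ := fun e => by
    rw [e, top_add] at key
    exact ENNReal.add_ne_top.2 ⟨hfin, hmul _ _⟩ key.symm
  have ha : 0 < t₂ - t₁ := sub_pos.2 h12
  have hb : 0 < t₃ - t₂ := sub_pos.2 h23
  have hformula : (expTime (transposedSearch S t₁ t₂ t₃) h).toReal - (expTime S h).toReal
      = (t₂ - t₁) * (t₃ - t₂) *
        (((h (S '' Icc 0 t₂)).toReal - (h (S '' Icc 0 t₁)).toReal) / (t₂ - t₁)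
          - ((h (S '' Icc 0 t₃)).toReal - (h (S '' Icc 0 t₂)).toReal) / (t₃ - t₂)) := by
    have key' := congrArg ENNReal.toReal key
    rw [ENNReal.toReal_add hfin' (hmul _ _), ENNReal.toReal_add hfin (hmul _ _),
      ENNReal.toReal_mul, ENNReal.toReal_mul, ENNReal.toReal_ofReal ha.le,
      ENNReal.toReal_ofReal hb.le, hdiff h12.le, hdiff h23.le] at key'
    field_simp
    linear_combination key'
  refine ⟨hfin', hformula, fun hρ => ⟨?_, ?_⟩⟩
  · rw [← ENNReal.toReal_le_toReal hfin hfin', ← sub_nonneg, hformula]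
    exact mul_nonneg (mul_pos ha hb).le (sub_nonneg.2 hρ)
  · rw [← ENNReal.toReal_eq_toReal_iff' hfin hfin', eq_comm, ← sub_eq_zero, hformula,
      mul_eq_zero_iff_left (mul_pos ha hb).ne', sub_eq_zero]

end
end

section
/- If the hiding distribution h on Q is balanced, then the expected search time of each depth-first search is T(S⁺,h) = T(S⁻,h) = μ − ∫_Q λ(Q_x) dh(x). -/
open MeasureTheory Set Filter
open scoped ENNReal

noncomputable section

/-- The depth-first search `S⁺`: unit speed from `0` to `l₁`, then to `-l₂`, then rests. -/
def Splus (l₁ l₂ : ℝ) (t : ℝ) : ℝ :=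
  if t ≤ l₁ then t else if t ≤ 2 * l₁ + l₂ then 2 * l₁ - t else -l₂

/-- The depth-first search `S⁻`: unit speed from `0` to `-l₂`, then to `l₁`, then rests. -/
def Sminus (l₁ l₂ : ℝ) (t : ℝ) : ℝ :=
  if t ≤ l₂ then -t else if t ≤ 2 * l₂ + l₁ then t - 2 * l₂ else l₁

/-- A hiding distribution is balanced if the two branches at the root have equal search
density: `λ₂ · h((0,λ₁]) = λ₁ · h([-λ₂,0))`. -/
def BalancedDist (l₁ l₂ : ℝ) (h : Measure ℝ) : Prop :=
  l₂ * (h (Ioc 0 l₁)).toReal = l₁ * (h (Ico (-l₂) 0)).toReal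

/-- The subtree `Q_x` above the point `x` of `Q = [-l₂, l₁]`. -/
def Qsub (l₁ l₂ x : ℝ) : Set ℝ :=
  if 0 < x then Icc x l₁ else if x < 0 then Icc (-l₂) x else Icc (-l₂) l₁

/-- The length `λ(Q_x)` of the subtree above `x`. -/
def lenQ (l₁ l₂ x : ℝ) : ℝ :=
  if 0 < x then l₁ - x else if x < 0 then l₂ + x else l₁ + l₂

/-- If `S` first reaches `x` at time `t`, then its search time of `x` is `t`. -/
lemma searchTime_eq_ofReal {S : ℝ → ℝ} {x t : ℝ} (ht : 0 ≤ t) (hS : S t = x)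
    (hmin : ∀ s, 0 ≤ s → S s = x → t ≤ s) : searchTime S x = ENNReal.ofReal t := by
  refine le_antisymm (sInf_le ⟨t, ⟨ht, hS⟩, rfl⟩) (le_sInf ?_)
  rintro _ ⟨s, ⟨hs, hsx⟩, rfl⟩
  exact ENNReal.ofReal_le_ofReal (hmin s hs hsx)

lemma searchTime_Splus {l₁ l₂ x : ℝ} (hl₁ : 0 < l₁) (hx : x ∈ Icc (-l₂) l₁) :
    searchTime (Splus l₁ l₂) x = ENNReal.ofReal (if x < 0 then 2 * l₁ - x else x) := by
  obtain ⟨h₁, h₂⟩ := hx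
  apply searchTime_eq_ofReal
  · split_ifs <;> linarith
  · unfold Splus
    split_ifs <;> linarith
  · intro s hs hsx
    unfold Splus at hsx
    split_ifs at hsx ⊢ <;> linarith

lemma Sminus_eq_neg_Splus (l₁ l₂ t : ℝ) : Sminus l₁ l₂ t = -Splus l₂ l₁ t := by
  unfold Sminus Splus
  split_ifs <;> ring

lemma searchTime_Sminus {l₁ l₂ x : ℝ} (hl₂ : 0 < l₂) (hx : x ∈ Icc (-l₂) l₁) :
    searchTime (Sminus l₁ l₂) x = ENNReal.ofReal (if 0 < x then 2 * l₂ + x else -x) := by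
  have hneg : searchTime (Sminus l₁ l₂) x = searchTime (Splus l₂ l₁) (-x) := by
    simp only [searchTime, Sminus_eq_neg_Splus, neg_eq_iff_eq_neg]
  rw [hneg, searchTime_Splus hl₂ ⟨neg_le_neg hx.2, neg_le.mp hx.1⟩]
  simp only [neg_lt_zero, sub_neg_eq_add]

lemma measurable_lenQ (l₁ l₂ : ℝ) : Measurable (lenQ l₁ l₂) :=
  Measurable.ite measurableSet_Ioi (by fun_prop)
    (Measurable.ite measurableSet_Iio (by fun_prop) measurable_const)

lemma ae_mem_Icc_of_measure_eq_one {a b : ℝ} {h : Measure ℝ} [IsProbabilityMeasure h]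
    (hsupp : h (Icc a b) = 1) : ∀ᵐ x ∂h, x ∈ Icc a b :=
  (mem_ae_iff_prob_eq_one measurableSet_Icc).mpr hsupp

lemma integrable_lenQ {l₁ l₂ : ℝ} (hl₁ : 0 < l₁) (hl₂ : 0 < l₂) {h : Measure ℝ}
    [IsProbabilityMeasure h] (hsupp : h (Icc (-l₂) l₁) = 1) : Integrable (lenQ l₁ l₂) h := by
  refine Integrable.of_bound (measurable_lenQ l₁ l₂).aestronglyMeasurable (l₁ + l₂) ?_
  filter_upwards [ae_mem_Icc_of_measure_eq_one hsupp] with x ⟨h₁, h₂⟩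
  rw [Real.norm_eq_abs, abs_le]
  unfold lenQ
  constructor <;> split_ifs <;> linarith

/-- The signed indicator of the two branches that integrates to zero against balanced
distributions. -/
def branchWeight (l₁ l₂ x : ℝ) : ℝ :=
  (Ioc 0 l₁).indicator (fun _ => l₂) x - (Ico (-l₂) 0).indicator (fun _ => l₁) x

lemma integrable_branchWeight (l₁ l₂ : ℝ) (h : Measure ℝ) [IsFiniteMeasure h] :
    Integrable (branchWeight l₁ l₂) h :=
  ((integrable_const l₂).indicator measurableSet_Ioc).sub
    ((integrable_const l₁).indicator measurableSet_Ico)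

lemma BalancedDist.integral_branchWeight {l₁ l₂ : ℝ} {h : Measure ℝ} [IsFiniteMeasure h]
    (hbal : BalancedDist l₁ l₂ h) : ∫ x, branchWeight l₁ l₂ x ∂h = 0 := by
  unfold branchWeight
  rw [integral_sub ((integrable_const l₂).indicator measurableSet_Ioc)
    ((integrable_const l₁).indicator measurableSet_Ico),
    integral_indicator_const _ measurableSet_Ioc, integral_indicator_const _ measurableSet_Ico]
  unfold BalancedDist at hbal
  simp only [Measure.real, smul_eq_mul]
  linarith

/-- The expected search time of a balanced distribution does not see multiples of
`branchWeight` in the search time. -/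
lemma BalancedDist.expTime_eq {l₁ l₂ : ℝ} (hl₁ : 0 < l₁) (hl₂ : 0 < l₂) {h : Measure ℝ}
    [IsProbabilityMeasure h] (hsupp : h (Icc (-l₂) l₁) = 1) (hbal : BalancedDist l₁ l₂ h)
    {S f : ℝ → ℝ} {c : ℝ} (hS : ∀ x ∈ Icc (-l₂) l₁, searchTime S x = ENNReal.ofReal (f x))
    (hf₀ : ∀ x ∈ Icc (-l₂) l₁, 0 ≤ f x)
    (hf : ∀ x ∈ Icc (-l₂) l₁, f x = (l₁ + l₂) - lenQ l₁ l₂ x + c * branchWeight l₁ l₂ x) :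
    expTime S h = ENNReal.ofReal ((l₁ + l₂) - ∫ x, lenQ l₁ l₂ x ∂h) := by
  have hQ := ae_mem_Icc_of_measure_eq_one hsupp
  have hlen : Integrable (fun x => (l₁ + l₂) - lenQ l₁ l₂ x) h :=
    (integrable_const _).sub (integrable_lenQ hl₁ hl₂ hsupp)
  have hw := (integrable_branchWeight l₁ l₂ h).const_mul c
  have hfae : f =ᵐ[h] fun x => (l₁ + l₂) - lenQ l₁ l₂ x + c * branchWeight l₁ l₂ x :=
    hQ.mono hf
  have hfi : Integrable f h := (hlen.add hw).congr hfae.symm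
  have hint : ∫ x, f x ∂h = (l₁ + l₂) - ∫ x, lenQ l₁ l₂ x ∂h := by
    rw [integral_congr_ae hfae, integral_add hlen hw,
      integral_sub (integrable_const _) (integrable_lenQ hl₁ hl₂ hsupp), integral_const_mul,
      hbal.integral_branchWeight]
    simp
  rw [← hint, ofReal_integral_eq_lintegral_ofReal hfi (hQ.mono hf₀)]
  exact lintegral_congr_ae (hQ.mono hS)

/-- If `h` is balanced then the expected search time of each depth-first search equals
`μ - ∫_Q λ(Q_x) dh(x)`. -/
theorem DF_time_of_balanced (l₁ l₂ : ℝ) (hl₁ : 0 < l₁) (hl₂ : 0 < l₂)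
    (h : Measure ℝ) [IsProbabilityMeasure h] (hsupp : h (Icc (-l₂) l₁) = 1)
    (hbal : BalancedDist l₁ l₂ h) :
    expTime (Splus l₁ l₂) h
        = ENNReal.ofReal ((l₁ + l₂) - ∫ x, lenQ l₁ l₂ x ∂h) ∧
      expTime (Sminus l₁ l₂) h
        = ENNReal.ofReal ((l₁ + l₂) - ∫ x, lenQ l₁ l₂ x ∂h) := by
  constructor
  · refine hbal.expTime_eq hl₁ hl₂ hsupp (c := -1) (fun _ => searchTime_Splus hl₁) ?_ ?_
    · rintro x -
      split_ifs <;> linarith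
    · rintro x ⟨h₁, h₂⟩
      simp only [branchWeight, lenQ, indicator_apply, mem_Ioc, mem_Ico, h₁, h₂, and_true,
        true_and]
      split_ifs <;> linarith
  · refine hbal.expTime_eq hl₁ hl₂ hsupp (c := 1) (fun _ => searchTime_Sminus hl₂) ?_ ?_
    · rintro x -
      split_ifs <;> linarith
    · rintro x ⟨h₁, h₂⟩
      simp only [branchWeight, lenQ, indicator_apply, mem_Ioc, mem_Ico, h₁, h₂, and_true,
        true_and]
      split_ifs <;> linarith

end
end

section
/- If the hiding distribution h on Q is monotone, then: (i) h has no atoms except possibly at the leaf nodes, i.e. h({x}) = 0 for every x ∈ (−λ₂, λ₁); (ii) the branch-density function x ↦ h(Q_x)/λ(Q_x) (which takes the value 1/μ at x = 0) is continuous on (−λ₂, λ₁); and (iii) h is balanced. -/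
open MeasureTheory Set Filter
open scoped ENNReal

noncomputable section

/-- A hiding distribution on `Q = [-l₂, l₁]` is monotone if branch density is
nondecreasing away from the root along each arc, and at least the overall density
`1/μ` everywhere. -/
def MonotoneDist (l₁ l₂ : ℝ) (h : Measure ℝ) : Prop :=
  (∀ x y : ℝ, 0 < x → x ≤ y → y < l₁ →
    (h (Icc x l₁)).toReal / (l₁ - x) ≤ (h (Icc y l₁)).toReal / (l₁ - y)) ∧
  (∀ x y : ℝ, 0 < x → x ≤ y → y < l₂ →
    (h (Icc (-l₂) (-x))).toReal / (l₂ - x) ≤ (h (Icc (-l₂) (-y))).toReal / (l₂ - y)) ∧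
  (∀ x : ℝ, 0 < x → x < l₁ → 1 / (l₁ + l₂) ≤ (h (Icc x l₁)).toReal / (l₁ - x)) ∧
  (∀ x : ℝ, 0 < x → x < l₂ → 1 / (l₁ + l₂) ≤ (h (Icc (-l₂) (-x))).toReal / (l₂ - x))

/-- The branch density function `x ↦ h(Q_x)/λ(Q_x)`, taking the value `1/μ` at the
root. -/
def branchDensity (l₁ l₂ : ℝ) (h : Measure ℝ) (x : ℝ) : ℝ :=
  if 0 < x then (h (Icc x l₁)).toReal / (l₁ - x)
  else if x < 0 then (h (Icc (-l₂) x)).toReal / (l₂ + x)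
  else 1 / (l₁ + l₂)

/-- If branch density is nondecreasing along an arc of length `l`, then the mass above a point
depends continuously on the point. -/
theorem continuousOn_measure_Icc_of_density_mono (h : Measure ℝ) [IsProbabilityMeasure h] (l : ℝ)
    (hm : ∀ x y : ℝ, 0 < x → x ≤ y → y < l →
      h.real (Icc x l) / (l - x) ≤ h.real (Icc y l) / (l - y)) :
    ContinuousOn (fun x => h.real (Icc x l)) (Ioo 0 l) := by
  intro z hz
  obtain ⟨b, hzb, hbl⟩ := exists_between hz.2
  have hlip : LipschitzOnWith (1 / (l - b)).toNNReal (fun x => h.real (Icc x l)) (Ioo 0 b) := by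
    refine LipschitzOnWith.of_le_add_mul _ fun x hx y hy => ?_
    have hpos : 0 < 1 / (l - b) := one_div_pos.2 (sub_pos.2 hbl)
    rw [Real.coe_toNNReal _ hpos.le]
    rcases le_total y x with hyx | hxy
    · have hle : h.real (Icc x l) ≤ h.real (Icc y l) := measureReal_mono (Icc_subset_Icc_left hyx)
      have := mul_nonneg hpos.le (dist_nonneg (x := x) (y := y))
      linarith
    · have hyl : 0 < l - y := by linarith [hy.2]
      have hxl : 0 < l - x := by linarith
      have hratio := hm x y hx.1 hxy (by linarith)
      rw [div_le_iff₀ hxl] at hratio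
      have hone : h.real (Icc y l) / (l - y) ≤ 1 / (l - b) :=
        div_le_div₀ zero_le_one measureReal_le_one (sub_pos.2 hbl) (by linarith [hy.2])
      have hdist : dist x y = y - x := by
        rw [dist_comm, Real.dist_eq, abs_of_nonneg (sub_nonneg.2 hxy)]
      have hsplit : h.real (Icc y l) / (l - y) * (l - x) =
          h.real (Icc y l) + h.real (Icc y l) / (l - y) * (y - x) := by
        field_simp
        ring
      have := mul_le_mul_of_nonneg_right hone (sub_nonneg.2 hxy)
      rw [hdist]
      linarith
  exact (hlip.continuousOn.continuousAt (Ioo_mem_nhds hz.1 hzb)).continuousWithinAt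

/-- If the mass above a point of an arc depends continuously on the point, then the arc has no
interior atoms. -/
theorem measure_singleton_eq_zero_of_continuousOn (h : Measure ℝ) [IsFiniteMeasure h] (l : ℝ)
    (hc : ContinuousOn (fun x => h.real (Icc x l)) (Ioo 0 l)) {x : ℝ} (hx : x ∈ Ioo 0 l) :
    h {x} = 0 := by
  have hat : ContinuousAt (fun x => h.real (Icc x l)) x :=
    hc.continuousAt (Ioo_mem_nhds hx.1 hx.2)
  have hlim : Tendsto (fun y => h.real (Icc x l) - h.real (Icc y l)) (nhdsWithin x (Ioi x))
      (nhds (h.real (Icc x l) - h.real (Icc x l))) :=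
    (hat.tendsto.mono_left nhdsWithin_le_nhds).const_sub _
  have hle : h.real {x} ≤ h.real (Icc x l) - h.real (Icc x l) := by
    refine ge_of_tendsto hlim ?_
    filter_upwards [self_mem_nhdsWithin] with y hy
    have hxy : x < y := hy
    have hdisj : Disjoint ({x} : Set ℝ) (Icc y l) :=
      disjoint_singleton_left.2 fun hmem => absurd hmem.1 hxy.not_ge
    have hsub : ({x} : Set ℝ) ∪ Icc y l ⊆ Icc x l :=
      union_subset (singleton_subset_iff.2 ⟨le_rfl, hx.2.le⟩) (Icc_subset_Icc_left hxy.le)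
    have := measureReal_mono (μ := h) hsub
    rw [measureReal_union hdisj measurableSet_Icc] at this
    linarith
  rw [sub_self] at hle
  exact (measureReal_eq_zero_iff).1 (le_antisymm hle measureReal_nonneg)

/-- A lower bound on branch density along an arc bounds the mass of the whole arc. -/
theorem mul_le_measure_Ioc_of_le_density (h : Measure ℝ) [IsFiniteMeasure h] {l c : ℝ}
    (hl : 0 < l) (hc : ∀ x : ℝ, 0 < x → x < l → c ≤ h.real (Icc x l) / (l - x)) :
    c * l ≤ h.real (Ioc 0 l) := by
  have hlim : Tendsto (fun x : ℝ => c * (l - x)) (nhdsWithin 0 (Ioi 0)) (nhds (c * (l - 0))) :=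
    (Continuous.tendsto (by fun_prop) 0).mono_left nhdsWithin_le_nhds
  rw [sub_zero] at hlim
  refine le_of_tendsto hlim ?_
  filter_upwards [Ioo_mem_nhdsGT hl] with x hx
  have := hc x hx.1 hx.2
  rw [le_div_iff₀ (sub_pos.2 hx.2)] at this
  exact this.trans (measureReal_mono fun y hy => ⟨hx.1.trans_le hy.1, hy.2⟩)

/-- Reflecting a measure in the origin reflects the mass of a branch. -/
theorem map_neg_real_Icc (h : Measure ℝ) (a b : ℝ) :
    (h.map Neg.neg).real (Icc a b) = h.real (Icc (-b) (-a)) := by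
  rw [map_measureReal_apply measurable_neg measurableSet_Icc, neg_preimage, neg_Icc]

/-- If each branch density on an arc is at least the overall density, then the root has no mass
and each arc has mass proportional to its length. -/
theorem arc_masses_of_le_density (l₁ l₂ : ℝ) (hl₁ : 0 < l₁) (hl₂ : 0 < l₂)
    (h : Measure ℝ) [IsProbabilityMeasure h]
    (h₁ : ∀ x : ℝ, 0 < x → x < l₁ → 1 / (l₁ + l₂) ≤ h.real (Icc x l₁) / (l₁ - x))
    (h₂ : ∀ x : ℝ, 0 < x → x < l₂ → 1 / (l₁ + l₂) ≤ h.real (Icc (-l₂) (-x)) / (l₂ - x)) :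
    h {0} = 0 ∧ h.real (Ioc 0 l₁) = 1 / (l₁ + l₂) * l₁ ∧
      h.real (Ico (-l₂) 0) = 1 / (l₁ + l₂) * l₂ := by
  have : IsProbabilityMeasure (h.map Neg.neg) :=
    Measure.isProbabilityMeasure_map measurable_neg.aemeasurable
  have hright := mul_le_measure_Ioc_of_le_density h hl₁ h₁
  have hleft := mul_le_measure_Ioc_of_le_density (h.map Neg.neg) hl₂
    fun x hx hxl => by simpa only [map_neg_real_Icc] using h₂ x hx hxl
  rw [map_measureReal_apply measurable_neg measurableSet_Ioc, neg_preimage, neg_Ioc,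
    neg_zero] at hleft
  have hdisj : Disjoint (Ico (-l₂) 0 ∪ Ioc 0 l₁) ({0} : Set ℝ) := by simp
  have hdisj' : Disjoint (Ico (-l₂) 0) (Ioc 0 l₁) :=
    disjoint_left.2 fun x hx hx' => lt_asymm hx.2 hx'.1
  have hsum := measureReal_le_one (μ := h) (s := Ico (-l₂) 0 ∪ Ioc 0 l₁ ∪ {0})
  rw [measureReal_union hdisj (measurableSet_singleton 0),
    measureReal_union hdisj' measurableSet_Ioc] at hsum
  have hone : 1 / (l₁ + l₂) * l₁ + 1 / (l₁ + l₂) * l₂ = 1 := by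
    field_simp
  have hzero := measureReal_nonneg (μ := h) (s := {0})
  exact ⟨(measureReal_eq_zero_iff).1 (by linarith), by linarith, by linarith⟩

/-- A monotone hiding distribution has no atoms away from the leaves, has continuous
branch density on the interior, and is balanced. -/
theorem monotone_props (l₁ l₂ : ℝ) (hl₁ : 0 < l₁) (hl₂ : 0 < l₂)
    (h : Measure ℝ) [IsProbabilityMeasure h] (hsupp : h (Icc (-l₂) l₁) = 1)
    (hmono : MonotoneDist l₁ l₂ h) :
    (∀ x ∈ Ioo (-l₂) l₁, h {x} = 0) ∧
      ContinuousOn (branchDensity l₁ l₂ h) (Ioo (-l₂) l₁) ∧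
      BalancedDist l₁ l₂ h := by
  have : IsProbabilityMeasure (h.map Neg.neg) :=
    Measure.isProbabilityMeasure_map measurable_neg.aemeasurable
  obtain ⟨hm₁, hm₂, hd₁, hd₂⟩ := hmono
  simp only [← measureReal_def] at hm₁ hm₂ hd₁ hd₂
  obtain ⟨hroot, hright, hleft⟩ := arc_masses_of_le_density l₁ l₂ hl₁ hl₂ h hd₁ hd₂
  have hc₁ := continuousOn_measure_Icc_of_density_mono h l₁ hm₁
  have hc₂ := continuousOn_measure_Icc_of_density_mono (h.map Neg.neg) l₂
    fun x y hx hxy hyl => by simpa only [map_neg_real_Icc] using hm₂ x y hx hxy hyl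
  refine ⟨fun x hx => ?_, fun x hx => ?_, ?_⟩
  · rcases lt_trichotomy x 0 with hneg | rfl | hpos
    · have := measure_singleton_eq_zero_of_continuousOn (h.map Neg.neg) l₂ hc₂ (x := -x)
        ⟨neg_pos.2 hneg, by linarith [hx.1]⟩
      rwa [Measure.map_apply measurable_neg (measurableSet_singleton _), neg_preimage,
        neg_singleton, neg_neg] at this
    · exact hroot
    · exact measure_singleton_eq_zero_of_continuousOn h l₁ hc₁ ⟨hpos, hx.2⟩
  · apply ContinuousAt.continuousWithinAt
    rcases lt_trichotomy x 0 with hneg | rfl | hpos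
    · have hmass : ContinuousAt (fun y => (h.map Neg.neg).real (Icc (-y) l₂)) x :=
        ContinuousAt.comp (f := Neg.neg) (g := fun y => (h.map Neg.neg).real (Icc y l₂))
          (hc₂.continuousAt (Ioo_mem_nhds (neg_pos.2 hneg) (by linarith [hx.1])))
          continuousAt_neg
      refine (hmass.div (by fun_prop : ContinuousAt (fun y => l₂ + y) x)
        (by linarith [hx.1])).congr ?_
      filter_upwards [Iio_mem_nhds hneg] with y hy
      have hy0 : y < 0 := hy
      simp [branchDensity, hy0, hy0.not_gt, map_neg_real_Icc, ← measureReal_def]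
    · have hlower : ∀ᶠ y in nhds 0, 1 / (l₁ + l₂) ≤ branchDensity l₁ l₂ h y := by
        filter_upwards [Ioo_mem_nhds hx.1 hx.2] with y hy
        unfold branchDensity
        split_ifs with hpos hneg
        · exact hd₁ y hpos hy.2
        · simpa [measureReal_def] using hd₂ (-y) (neg_pos.2 hneg) (by linarith [hy.1])
        · exact le_rfl
      have hupper : ∀ᶠ y in nhds 0, branchDensity l₁ l₂ h y ≤
          max (1 / (l₁ + l₂) * l₁ / (l₁ - y)) (1 / (l₁ + l₂) * l₂ / (l₂ + y)) := by
        filter_upwards [Ioo_mem_nhds hx.1 hx.2] with y hy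
        have hy₁ : 0 < l₁ - y := by linarith [hy.2]
        have hy₂ : 0 < l₂ + y := by linarith [hy.1]
        unfold branchDensity
        split_ifs with hpos hneg
        · rw [← hright, ← measureReal_def]
          refine le_max_of_le_left (div_le_div_of_nonneg_right ?_ hy₁.le)
          exact measureReal_mono fun z hz => ⟨hpos.trans_le hz.1, hz.2⟩
        · rw [← hleft, ← measureReal_def]
          refine le_max_of_le_right (div_le_div_of_nonneg_right ?_ hy₂.le)
          exact measureReal_mono fun z hz => ⟨hz.1, hz.2.trans_lt hneg⟩
        · obtain rfl : y = 0 := le_antisymm (not_lt.1 hpos) (not_lt.1 hneg)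
          refine le_max_of_le_left ?_
          rw [sub_zero, mul_div_cancel_right₀ _ hl₁.ne']
      have hlim : ContinuousAt (fun y : ℝ =>
          max (1 / (l₁ + l₂) * l₁ / (l₁ - y)) (1 / (l₁ + l₂) * l₂ / (l₂ + y))) 0 := by
        refine ContinuousAt.sup ?_ ?_
        · exact continuousAt_const.div (by fun_prop) (by simpa using hl₁.ne')
        · exact continuousAt_const.div (by fun_prop) (by simpa using hl₂.ne')
      have hval : max (1 / (l₁ + l₂) * l₁ / (l₁ - 0)) (1 / (l₁ + l₂) * l₂ / (l₂ + 0)) =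
          branchDensity l₁ l₂ h 0 := by
        rw [sub_zero, add_zero, mul_div_cancel_right₀ _ hl₁.ne', mul_div_cancel_right₀ _ hl₂.ne',
          max_self]
        simp [branchDensity]
      have hroot_val : branchDensity l₁ l₂ h 0 = 1 / (l₁ + l₂) := by simp [branchDensity]
      have hlim' := hlim.tendsto
      rw [hval] at hlim'
      refine tendsto_of_tendsto_of_tendsto_of_le_of_le' ?_ hlim' hlower hupper
      rw [hroot_val]
      exact tendsto_const_nhds
    · refine ((hc₁.continuousAt (Ioo_mem_nhds hpos hx.2)).div
        (by fun_prop : ContinuousAt (fun y => l₁ - y) x) (by linarith [hx.2])).congr ?_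
      filter_upwards [Ioi_mem_nhds hpos] with y hy
      have hy0 : 0 < y := hy
      simp [branchDensity, hy0, measureReal_def]
  · rw [BalancedDist, ← measureReal_def, ← measureReal_def, hright, hleft]
    ring

end
end

section
/- If the hiding distribution h on Q is monotone, then the value of the search problem, V(h) = inf over all searches S of T(S,h), is given by V(h) = μ − ∫_Q λ(Q_x) dh(x). -/
open MeasureTheory Set Filter
open scoped ENNReal

noncomputable section

/-- Search times of the points of the positive arc, extended by `0` to a monotone function. -/
def arcTime (S : ℝ → ℝ) (x : ℝ) : ℝ≥0∞ := if 0 < x then searchTime S x else 0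

theorem searchTime_neg (S : ℝ → ℝ) (x : ℝ) :
    searchTime (fun t => -S t) x = searchTime S (-x) := by
  simp only [searchTime, neg_eq_iff_eq_neg]

theorem searchTime_le_s11 {S : ℝ → ℝ} {x t : ℝ} (ht : 0 ≤ t) (hS : S t = x) :
    searchTime S x ≤ ENNReal.ofReal t :=
  sInf_le ⟨t, ⟨ht, hS⟩, rfl⟩

theorem monotone_arcTime {S : ℝ → ℝ} (h0 : S 0 = 0)
    (hS : ∀ s t, 0 ≤ s → 0 ≤ t → |S s - S t| ≤ |s - t|) : Monotone (arcTime S) := by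
  intro x x' hxx
  unfold arcTime
  split_ifs with hx hx'
  · refine le_sInf ?_
    rintro _ ⟨t, ⟨ht, rfl⟩, rfl⟩
    have hcont : ContinuousOn S (Icc 0 t) := by
      refine LipschitzOnWith.continuousOn (K := 1) (LipschitzOnWith.of_dist_le_mul ?_)
      intro a ha b hb
      simpa [Real.dist_eq] using hS a b ha.1 hb.1
    obtain ⟨s, hs, hsx⟩ := intermediate_value_Icc ht hcont
      (show x ∈ Icc (S 0) (S t) from ⟨h0.le.trans hx.le, hxx⟩)
    exact (searchTime_le_s11 hs.1 hsx).trans (ENNReal.ofReal_le_ofReal hs.2)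
  · exact absurd (hx.trans_le hxx) hx'
  · exact zero_le
  · exact le_rfl

theorem ofReal_le_searchTime {S : ℝ → ℝ} (h0 : S 0 = 0)
    (hS : ∀ s t, 0 ≤ s → 0 ≤ t → |S s - S t| ≤ |s - t|)
    (x : ℝ) : ENNReal.ofReal x ≤ searchTime S x := by
  refine le_sInf ?_
  rintro _ ⟨t, ⟨ht, rfl⟩, rfl⟩
  have := hS t 0 ht le_rfl
  rw [h0, sub_zero, sub_zero, abs_of_nonneg ht] at this
  exact ENNReal.ofReal_le_ofReal ((le_abs_self _).trans this)

/-- If `y` is reached no later than the point `-x` of the opposite arc, then reaching `-x`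
requires going to `y` and back first. -/
theorem ofReal_le_searchTime_of_le {S : ℝ → ℝ} (h0 : S 0 = 0)
    (hS : ∀ s t, 0 ≤ s → 0 ≤ t → |S s - S t| ≤ |s - t|)
    {x y : ℝ} (hx : 0 < x) (hy : 0 < y)
    (hle : searchTime S y ≤ searchTime S (-x)) :
    ENNReal.ofReal (2 * y + x) ≤ searchTime S (-x) := by
  refine le_sInf ?_
  rintro _ ⟨t, ⟨ht, htx⟩, rfl⟩
  have hlt : searchTime S y < ENNReal.ofReal (t + (x + y)) :=
    (hle.trans (searchTime_le_s11 ht htx)).trans_lt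
      ((ENNReal.ofReal_lt_ofReal_iff (by linarith)).2 (by linarith))
  obtain ⟨_, ⟨s, ⟨hs, hsy⟩, rfl⟩, hst⟩ := sInf_lt_iff.1 hlt
  have hst := (ENNReal.ofReal_lt_ofReal_iff (by linarith)).1 hst
  apply ENNReal.ofReal_le_ofReal
  have h1 := hS s 0 hs le_rfl
  have h2 := hS s t hs ht
  rw [h0, hsy, sub_zero, sub_zero, abs_of_nonneg hs, abs_of_pos hy] at h1
  rw [hsy, htx, abs_of_pos (by linarith : 0 < y - -x)] at h2
  rcases le_total s t with hc | hc
  · rw [abs_of_nonpos (by linarith)] at h2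
    linarith
  · rw [abs_of_nonneg (by linarith)] at h2
    linarith

theorem ofReal_add_volume_le_searchTime {S : ℝ → ℝ} (h0 : S 0 = 0)
    (hS : ∀ s t, 0 ≤ s → 0 ≤ t → |S s - S t| ≤ |s - t|)
    {x l : ℝ} (hx : 0 < x) {A : Set ℝ}
    (hA : ∀ y ∈ A, 0 < y → searchTime S y ≤ searchTime S (-x)) :
    ENNReal.ofReal x + 2 * volume.restrict (Ioo 0 l) A ≤ searchTime S (-x) := by
  rcases eq_or_ne (searchTime S (-x)) ∞ with htop | htop
  · simp [htop]
  set u := (searchTime S (-x)).toReal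
  have hu : searchTime S (-x) = ENNReal.ofReal u := (ENNReal.ofReal_toReal htop).symm
  have hxu : x ≤ u := by
    have := ofReal_le_searchTime (S := fun t => -S t) (by simp [h0])
      (fun s t hs ht => by rw [← neg_sub', abs_neg]; exact hS s t hs ht) x
    rw [searchTime_neg, hu] at this
    exact (ENNReal.ofReal_le_ofReal_iff ENNReal.toReal_nonneg).1 this
  have hvol : volume.restrict (Ioo 0 l) A ≤ ENNReal.ofReal ((u - x) / 2) := by
    rw [Measure.restrict_apply' measurableSet_Ioo]
    refine (measure_mono (t := Icc 0 ((u - x) / 2)) ?_).trans (by simp)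
    rintro y ⟨hyA, hy, -⟩
    have := ofReal_le_searchTime_of_le h0 hS hx hy (hA y hyA hy)
    rw [hu, ENNReal.ofReal_le_ofReal_iff ENNReal.toReal_nonneg] at this
    exact ⟨hy.le, by linarith⟩
  calc ENNReal.ofReal x + 2 * volume.restrict (Ioo 0 l) A
      ≤ ENNReal.ofReal x + ENNReal.ofReal 2 * ENNReal.ofReal ((u - x) / 2) := by
        rw [ENNReal.ofReal_ofNat]; gcongr
    _ = searchTime S (-x) := by
        rw [← ENNReal.ofReal_mul zero_le_two, ← ENNReal.ofReal_add hx.le (by linarith), hu]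
        congr 1; ring

/-- A measure dominating the uniform distribution of density `1 / M` on `(0, l)` in the
stochastic order gives larger integrals to the sections of a set that is upward closed in its
first coordinate. -/
theorem prod_le_mul_lintegral_section {l l' M : ℝ} {ν : Measure ℝ} [IsFiniteMeasure ν]
    (hM : 0 ≤ M)
    (hν : ∀ x, 0 < x → x < l → ENNReal.ofReal (l - x) ≤ ENNReal.ofReal M * ν (Ici x))
    {R : Set (ℝ × ℝ)} (hR : MeasurableSet R)
    (hup : ∀ x x' y, x ≤ x' → (x, y) ∈ R → (x', y) ∈ R) :
    ((volume.restrict (Ioo 0 l)).prod (volume.restrict (Ioo 0 l'))) R ≤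
      ENNReal.ofReal M * ∫⁻ x, volume.restrict (Ioo 0 l') (Prod.mk x ⁻¹' R) ∂ν := by
  rw [← Measure.prod_apply hR, Measure.prod_apply_symm hR, Measure.prod_apply_symm hR,
    ← lintegral_const_mul' _ _ ENNReal.ofReal_ne_top]
  refine lintegral_mono fun y => ?_
  set A : Set ℝ := (fun x => (x, y)) ⁻¹' R
  set K := M * (ν A).toReal
  have hK : ENNReal.ofReal K = ENNReal.ofReal M * ν A := by
    rw [ENNReal.ofReal_mul hM, ENNReal.ofReal_toReal (measure_ne_top _ _)]
  change _ ≤ ENNReal.ofReal M * ν A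
  rw [← hK, Measure.restrict_apply' measurableSet_Ioo]
  refine (measure_mono (t := Icc (l - K) l) ?_).trans (by simp)
  rintro x ⟨hxA, hx0, hxl⟩
  have hsub : Ici x ⊆ A := fun x' hx' => hup x x' y hx' hxA
  have h1 : ENNReal.ofReal (l - x) ≤ ENNReal.ofReal K := by
    rw [hK]
    exact (hν x hx0 hxl).trans (by gcongr)
  have := (ENNReal.ofReal_le_ofReal_iff (by positivity)).1 h1
  exact ⟨by linarith, hxl.le⟩

theorem prod_add_prod_swap_compl {l₁ l₂ : ℝ} (hl₁ : 0 ≤ l₁) {R : Set (ℝ × ℝ)}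
    (hR : MeasurableSet R) :
    ((volume.restrict (Ioo 0 l₁)).prod (volume.restrict (Ioo 0 l₂))) R +
      ((volume.restrict (Ioo 0 l₂)).prod (volume.restrict (Ioo 0 l₁))) (Prod.swap ⁻¹' Rᶜ) =
      ENNReal.ofReal (l₁ * l₂) := by
  rw [← Measure.map_apply measurable_swap hR.compl, Measure.prod_swap, measure_add_measure_compl hR,
    ← univ_prod_univ, Measure.prod_prod]
  simp [ENNReal.ofReal_mul hl₁]

/-- The lower bound for the expected search time, in terms of the distributions `ν₁` and `ν₂` of
the distance to the root on the two arcs. -/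
theorem le_lintegral_searchTime_add {S : ℝ → ℝ} (h0 : S 0 = 0)
    (hS : ∀ s t, 0 ≤ s → 0 ≤ t → |S s - S t| ≤ |s - t|) {l₁ l₂ M : ℝ} (hl₁ : 0 ≤ l₁)
    (hM : 0 < M) {ν₁ ν₂ : Measure ℝ} [IsFiniteMeasure ν₁] [IsFiniteMeasure ν₂]
    (hpos₁ : ∀ᵐ x ∂ν₁, 0 < x) (hpos₂ : ∀ᵐ x ∂ν₂, 0 < x)
    (hν₁ : ∀ x, 0 < x → x < l₁ → ENNReal.ofReal (l₁ - x) ≤ ENNReal.ofReal M * ν₁ (Ici x))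
    (hν₂ : ∀ x, 0 < x → x < l₂ → ENNReal.ofReal (l₂ - x) ≤ ENNReal.ofReal M * ν₂ (Ici x)) :
    ENNReal.ofReal (2 * (l₁ * l₂) / M) +
      (∫⁻ x, ENNReal.ofReal x ∂ν₁ + ∫⁻ x, ENNReal.ofReal x ∂ν₂) ≤
      ∫⁻ x, searchTime S x ∂ν₁ + ∫⁻ x, searchTime S (-x) ∂ν₂ := by
  set S' : ℝ → ℝ := fun t => -S t
  have h0' : S' 0 = 0 := by simp [S', h0]
  have hS' : ∀ s t, 0 ≤ s → 0 ≤ t → |S' s - S' t| ≤ |s - t| := fun s t hs ht => by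
    simp only [S']; rw [← neg_sub', abs_neg]; exact hS s t hs ht
  have hS'neg : ∀ x, searchTime S' (-x) = searchTime S x := fun x => by
    rw [searchTime_neg, neg_neg]
  have mf := monotone_arcTime h0 hS
  have mg := monotone_arcTime h0' hS'
  set R : Set (ℝ × ℝ) := {p | arcTime S' p.2 ≤ arcTime S p.1}
  have hR : MeasurableSet R := measurableSet_le (mg.measurable.comp measurable_snd)
    (mf.measurable.comp measurable_fst)
  have hR' : MeasurableSet (Prod.swap ⁻¹' Rᶜ) := measurable_swap hR.compl
  have e₁ := prod_le_mul_lintegral_section (l' := l₂) hM.le hν₁ hR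
    (fun x x' y hx hxy => le_trans hxy (mf hx))
  have e₂ := prod_le_mul_lintegral_section (l' := l₁) hM.le hν₂ hR'
    (fun x x' y hx hxy hle => hxy (le_trans (mg hx) hle))
  set J₁ := ∫⁻ x, volume.restrict (Ioo 0 l₂) (Prod.mk x ⁻¹' R) ∂ν₁
  set J₂ := ∫⁻ x, volume.restrict (Ioo 0 l₁) (Prod.mk x ⁻¹' (Prod.swap ⁻¹' Rᶜ)) ∂ν₂
  have hJ : ENNReal.ofReal (2 * (l₁ * l₂) / M) ≤ 2 * (J₁ + J₂) := by
    have := add_le_add e₁ e₂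
    rw [prod_add_prod_swap_compl hl₁ hR, ← mul_add] at this
    rw [mul_div_assoc, ENNReal.ofReal_mul zero_le_two, ENNReal.ofReal_ofNat,
      ENNReal.ofReal_div_of_pos hM]
    gcongr
    exact ENNReal.div_le_of_le_mul' this
  have i₁ : ∫⁻ x, ENNReal.ofReal x ∂ν₁ + 2 * J₁ ≤ ∫⁻ x, searchTime S x ∂ν₁ := by
    rw [← lintegral_const_mul' _ _ (by simp), ← lintegral_add_left (by fun_prop)]
    refine lintegral_mono_ae ?_
    filter_upwards [hpos₁] with x hx
    rw [← hS'neg]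
    refine ofReal_add_volume_le_searchTime h0' hS' hx fun y hy hy0 => ?_
    rw [hS'neg]
    simpa [R, arcTime, hx, hy0] using hy
  have i₂ : ∫⁻ x, ENNReal.ofReal x ∂ν₂ + 2 * J₂ ≤ ∫⁻ x, searchTime S (-x) ∂ν₂ := by
    rw [← lintegral_const_mul' _ _ (by simp), ← lintegral_add_left (by fun_prop)]
    refine lintegral_mono_ae ?_
    filter_upwards [hpos₂] with x hx
    refine ofReal_add_volume_le_searchTime h0 hS hx fun y hy hy0 => ?_
    have : searchTime S y < searchTime S' x := by simpa [R, arcTime, hx, hy0] using hy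
    rw [searchTime_neg] at this
    exact this.le
  refine le_trans ?_ (add_le_add i₁ i₂)
  rw [add_add_add_comm, ← mul_add, add_comm]
  gcongr

/-- The search that first goes to the end of the positive arc, then to the other end. -/
theorem isSearch_depthFirst {l₁ l₂ : ℝ} (hl₁ : 0 ≤ l₁) (hl₂ : 0 ≤ l₂) :
    IsSearch l₁ l₂ (fun t => max (-l₂) (min t (2 * l₁ - t))) := by
  refine ⟨by simp [hl₁, hl₂], fun t ht => ⟨le_max_left _ _, max_le (by linarith) ?_⟩, ?_⟩
  · rcases le_total t l₁ with hc | hc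
    · exact (min_le_left _ _).trans hc
    · exact (min_le_right _ _).trans (by linarith)
  · intro s t _ _
    refine (abs_max_sub_max_le_max _ _ _ _).trans ?_
    rw [sub_self, abs_zero, max_eq_right (abs_nonneg _)]
    refine (abs_min_sub_min_le_max _ _ _ _).trans (max_le le_rfl ?_)
    rw [sub_sub_sub_cancel_left, abs_sub_comm]

theorem le_measure_of_density {l M : ℝ} (hl : 0 < l) (hM : 0 < M) {ν : Measure ℝ}
    [IsFiniteMeasure ν]
    (hν : ∀ x, 0 < x → x < l → ENNReal.ofReal (l - x) ≤ ENNReal.ofReal M * ν (Ici x)) :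
    l / M ≤ (ν univ).toReal := by
  refine le_of_forall_pos_sub_le fun ε hε => ?_
  obtain ⟨x, hx0, hx⟩ := exists_between (lt_min hl (mul_pos hε hM))
  have h1 : ENNReal.ofReal (l - x) ≤ ENNReal.ofReal (M * (ν univ).toReal) := by
    rw [ENNReal.ofReal_mul hM.le, ENNReal.ofReal_toReal (measure_ne_top _ _)]
    exact (hν x hx0 (hx.trans_le (min_le_left _ _))).trans (by gcongr; exact subset_univ _)
  have h2 := (ENNReal.ofReal_le_ofReal_iff (by positivity)).1 h1
  have h3 := hx.trans_le (min_le_right _ _)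
  rw [sub_le_iff_le_add, div_le_iff₀ hM]
  linarith

/-- For a monotone hiding distribution, the value of the search problem (the infimum of
the expected search time over all searches) equals `μ - ∫_Q λ(Q_x) dh(x)`. -/
theorem monotone_value (l₁ l₂ : ℝ) (hl₁ : 0 < l₁) (hl₂ : 0 < l₂)
    (h : Measure ℝ) [IsProbabilityMeasure h] (hsupp : h (Icc (-l₂) l₁) = 1)
    (hmono : MonotoneDist l₁ l₂ h) :
    (⨅ S : {S : ℝ → ℝ // IsSearch l₁ l₂ S}, expTime S.1 h)
      = ENNReal.ofReal ((l₁ + l₂) - ∫ x, lenQ l₁ l₂ x ∂h) := by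
  have hM : 0 < l₁ + l₂ := by linarith
  set ρ₁ := h.restrict (Ioc 0 l₁) with hρ₁
  set ρ₂ := h.restrict (Ico (-l₂) 0) with hρ₂
  set ν₂ := ρ₂.map (fun x => -x) with hν₂def
  have hmem₁ : ∀ᵐ x ∂ρ₁, x ∈ Ioc 0 l₁ := ae_restrict_mem measurableSet_Ioc
  have hmem₂ : ∀ᵐ x ∂ρ₂, x ∈ Ico (-l₂) 0 := ae_restrict_mem measurableSet_Ico
  have hlint₂ : ∀ f : ℝ → ℝ≥0∞, ∫⁻ x, f x ∂ν₂ = ∫⁻ x, f (-x) ∂ρ₂ := fun f =>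
    lintegral_map_equiv f (MeasurableEquiv.neg ℝ)
  have hd : ∀ {l x : ℝ} {a : ℝ≥0∞}, x < l → a ≠ ∞ → 1 / (l₁ + l₂) ≤ a.toReal / (l - x) →
      ENNReal.ofReal (l - x) ≤ ENNReal.ofReal (l₁ + l₂) * a := by
    intro l x a hxl ha hle
    rw [div_le_div_iff₀ hM (by linarith), one_mul] at hle
    rw [← ENNReal.ofReal_toReal ha, ← ENNReal.ofReal_mul hM.le, mul_comm]
    exact ENNReal.ofReal_le_ofReal hle
  have hν₁ : ∀ x, 0 < x → x < l₁ →
      ENNReal.ofReal (l₁ - x) ≤ ENNReal.ofReal (l₁ + l₂) * ρ₁ (Ici x) := by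
    intro x hx hxl
    have hset : Ici x ∩ Ioc 0 l₁ = Icc x l₁ := by
      ext z; simp only [mem_inter_iff, mem_Ici, mem_Ioc, mem_Icc]; grind
    rw [hρ₁, Measure.restrict_apply' measurableSet_Ioc, hset]
    exact hd hxl (measure_ne_top _ _) (hmono.2.2.1 x hx hxl)
  have hν₂ : ∀ x, 0 < x → x < l₂ →
      ENNReal.ofReal (l₂ - x) ≤ ENNReal.ofReal (l₁ + l₂) * ν₂ (Ici x) := by
    intro x hx hxl
    have hset : (fun x : ℝ => -x) ⁻¹' Ici x ∩ Ico (-l₂) 0 = Icc (-l₂) (-x) := by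
      ext z; simp only [mem_inter_iff, mem_preimage, mem_Ici, mem_Ico, mem_Icc]; grind
    rw [hν₂def, Measure.map_apply measurable_neg measurableSet_Ici, hρ₂,
      Measure.restrict_apply' measurableSet_Ico, hset]
    exact hd hxl (measure_ne_top _ _) (hmono.2.2.2 x hx hxl)
  have hm₁ := le_measure_of_density hl₁ hM hν₁
  have hm₂ := le_measure_of_density hl₂ hM hν₂
  have hdisj : Disjoint (Ioc 0 l₁) (Ico (-l₂) 0) :=
    Set.disjoint_left.2 fun x hx hx' => hx.1.not_gt hx'.2
  have huniv₂ : ν₂ univ = ρ₂ univ := by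
    rw [hν₂def, Measure.map_apply measurable_neg MeasurableSet.univ, preimage_univ]
  rw [huniv₂] at hm₂
  have hunion : h (Ioc 0 l₁ ∪ Ico (-l₂) 0) = ρ₁ univ + ρ₂ univ := by
    rw [measure_union hdisj measurableSet_Ico, hρ₁, hρ₂, Measure.restrict_apply_univ,
      Measure.restrict_apply_univ]
  have hsum : (ρ₁ univ).toReal + (ρ₂ univ).toReal ≤ 1 := by
    rw [← ENNReal.toReal_add (measure_ne_top _ _) (measure_ne_top _ _), ← hunion]
    exact ENNReal.toReal_le_of_le_ofReal zero_le_one (by simpa using prob_le_one)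
  have hlM : l₁ / (l₁ + l₂) + l₂ / (l₁ + l₂) = 1 := by field_simp
  have hm₁' : (ρ₁ univ).toReal = l₁ / (l₁ + l₂) := by linarith
  have hm₂' : (ρ₂ univ).toReal = l₂ / (l₁ + l₂) := by linarith
  have hae : ∀ᵐ x ∂h, x ∈ Ioc 0 l₁ ∪ Ico (-l₂) 0 := by
    refine (prob_compl_eq_zero_iff (measurableSet_Ioc.union measurableSet_Ico)).2 ?_
    rw [hunion, ← ENNReal.toReal_eq_one_iff,
      ENNReal.toReal_add (measure_ne_top _ _) (measure_ne_top _ _), hm₁', hm₂', hlM]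
  have hdecomp : h = ρ₁ + ρ₂ := by
    rw [hρ₁, hρ₂, ← Measure.restrict_union hdisj measurableSet_Ico,
      Measure.restrict_eq_self_of_ae_mem hae]
  have hint₁ : Integrable (fun x : ℝ => x) ρ₁ := by
    refine Integrable.of_bound (by fun_prop) l₁ ?_
    filter_upwards [hmem₁] with x hx
    rw [Real.norm_eq_abs, abs_of_pos hx.1]
    exact hx.2
  have hint₂ : Integrable (fun x : ℝ => -x) ρ₂ := by
    refine Integrable.of_bound (by fun_prop) l₂ ?_
    filter_upwards [hmem₂] with x hx
    rw [Real.norm_eq_abs, abs_of_pos (by linarith [hx.2])]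
    linarith [hx.1]
  have hpos₁ : 0 ≤ᵐ[ρ₁] fun x : ℝ => x := by
    filter_upwards [hmem₁] with x hx using hx.1.le
  have hpos₂ : 0 ≤ᵐ[ρ₂] fun x : ℝ => -x := by
    filter_upwards [hmem₂] with x hx using neg_nonneg.2 hx.2.le
  set I₁ := ∫ x, x ∂ρ₁
  set I₂ := ∫ x, -x ∂ρ₂
  have hI₁ : ∫⁻ x, ENNReal.ofReal x ∂ρ₁ = ENNReal.ofReal I₁ :=
    (ofReal_integral_eq_lintegral_ofReal hint₁ hpos₁).symm
  have hI₂ : ∫⁻ x, ENNReal.ofReal (-x) ∂ρ₂ = ENNReal.ofReal I₂ :=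
    (ofReal_integral_eq_lintegral_ofReal hint₂ hpos₂).symm
  have hI₁0 : 0 ≤ I₁ := integral_nonneg_of_ae hpos₁
  have hI₂0 : 0 ≤ I₂ := integral_nonneg_of_ae hpos₂
  have hlen₁ : lenQ l₁ l₂ =ᵐ[ρ₁] fun x => l₁ - x := by
    filter_upwards [hmem₁] with x hx
    simp [lenQ, hx.1]
  have hlen₂ : lenQ l₁ l₂ =ᵐ[ρ₂] fun x => l₂ - -x := by
    filter_upwards [hmem₂] with x hx
    simp [lenQ, hx.2, hx.2.le.not_gt]
  have hlen : ∫ x, lenQ l₁ l₂ x ∂h =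
      l₁ * (l₁ / (l₁ + l₂)) - I₁ + (l₂ * (l₂ / (l₁ + l₂)) - I₂) := by
    have j₁ : Integrable (fun x => l₁ - x) ρ₁ := (integrable_const _).sub hint₁
    have j₂ : Integrable (fun x => l₂ - -x) ρ₂ := (integrable_const _).sub hint₂
    rw [hdecomp, integral_add_measure (j₁.congr hlen₁.symm) (j₂.congr hlen₂.symm),
      integral_congr_ae hlen₁, integral_congr_ae hlen₂,
      integral_sub (integrable_const _) hint₁, integral_sub (integrable_const _) hint₂,
      integral_const, integral_const, smul_eq_mul, smul_eq_mul, measureReal_def,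
      measureReal_def, hm₁', hm₂', mul_comm l₁, mul_comm l₂]
  have hval : (l₁ + l₂) - ∫ x, lenQ l₁ l₂ x ∂h = 2 * (l₁ * l₂) / (l₁ + l₂) + (I₁ + I₂) := by
    rw [hlen]; field_simp; ring
  have hc : 0 ≤ 2 * (l₁ * l₂) / (l₁ + l₂) := by positivity
  rw [hval, ENNReal.ofReal_add hc (add_nonneg hI₁0 hI₂0), ENNReal.ofReal_add hI₁0 hI₂0]
  have hexp : ∀ S : ℝ → ℝ, expTime S h =
      ∫⁻ x, searchTime S x ∂ρ₁ + ∫⁻ x, searchTime S x ∂ρ₂ := fun S => by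
    rw [expTime]
    conv_lhs => rw [hdecomp]
    rw [lintegral_add_measure]
  apply le_antisymm
  · refine (iInf_le _ ⟨_, isSearch_depthFirst hl₁.le hl₂.le⟩).trans ?_
    rw [hexp]
    have u₁ : ∫⁻ x, searchTime (fun t => max (-l₂) (min t (2 * l₁ - t))) x ∂ρ₁ ≤
        ENNReal.ofReal I₁ := by
      rw [← hI₁]
      refine lintegral_mono_ae ?_
      filter_upwards [hmem₁] with x hx
      refine searchTime_le_s11 hx.1.le ?_
      rw [min_eq_left (by linarith [hx.2]), max_eq_right (by linarith [hx.1])]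
    have u₂ : ∫⁻ x, searchTime (fun t => max (-l₂) (min t (2 * l₁ - t))) x ∂ρ₂ ≤
        ENNReal.ofReal (2 * (l₁ * l₂) / (l₁ + l₂)) + ENNReal.ofReal I₂ := by
      have hconst : ENNReal.ofReal (2 * (l₁ * l₂) / (l₁ + l₂)) =
          ∫⁻ _, ENNReal.ofReal (2 * l₁) ∂ρ₂ := by
        rw [lintegral_const, ← ENNReal.ofReal_toReal (measure_ne_top ρ₂ univ), hm₂',
          ← ENNReal.ofReal_mul (by positivity)]
        congr 1; ring
      rw [← hI₂, hconst, ← lintegral_add_left (by fun_prop)]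
      refine lintegral_mono_ae ?_
      filter_upwards [hmem₂] with x hx
      rw [← ENNReal.ofReal_add (by positivity) (neg_nonneg.2 hx.2.le)]
      refine searchTime_le_s11 (by linarith [hx.2]) ?_
      rw [min_eq_right (by linarith [hx.2]), max_eq_right (by linarith [hx.1])]
      ring
    refine (add_le_add u₁ u₂).trans_eq ?_
    ring
  · refine le_iInf fun S => ?_
    have hpos₂' : ∀ᵐ x ∂ν₂, 0 < x := by
      rw [hν₂def, ae_map_iff (by fun_prop) measurableSet_Ioi]
      filter_upwards [hmem₂] with x hx using neg_pos.2 hx.2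
    have := le_lintegral_searchTime_add S.2.1 S.2.2.2 hl₁.le hM
      (hmem₁.mono fun x hx => hx.1) hpos₂' hν₁ hν₂
    simp only [hlint₂, neg_neg, hI₁, hI₂] at this
    rwa [hexp]

end
end
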